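/- Let G = U(C_l; T_1, T_2, …, T_l) be a finite connected unicyclic graph, and write n_i = |V(T_i)|. Then Kf(G) = ∑_{i=1}^{l} W(T_i) + ∑_{1 ≤ i < j ≤ l} ( n_j·W_{v_i}(T_i) + n_i·n_j·(j−i)(l−j+i)/l + n_i·W_{v_j}(T_j) ). -/

import Mathlib

open scoped Classical

noncomputable section

namespace KfPaper

variable {V : Type*} {W : Type*}

/-- The energy of a potential `f` on graph `G`, viewing each edge as a unit resistor:
`(1/2) · ∑_{x,y adjacent} (f x - f y)²` (each edge counted twice, hence the `1/2`). -/
def energy [Fintype V] (G : SimpleGraph V) (f : V → ℝ) : ℝ :=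
  (1 / 2) * ∑ x : V, ∑ y : V, (if G.Adj x y then (f x - f y) ^ 2 else 0)

/-- The resistance distance (effective resistance) between `u` and `v`:
`r(u,v) = 1 / inf { energy f : f u = 1, f v = 0 }` and `r(u,u) = 0`. -/
def resistanceDistance [Fintype V] (G : SimpleGraph V) (u v : V) : ℝ :=
  if u = v then 0
  else 1 / sInf {e : ℝ | ∃ f : V → ℝ, f u = 1 ∧ f v = 0 ∧ energy G f = e}

/-- The Kirchhoff index: sum of resistance distances over unordered pairs of distinct
vertices (each ordered pair counted once via the factor `1/2`, diagonal terms vanish). -/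
def kirchhoffIndex [Fintype V] (G : SimpleGraph V) : ℝ :=
  (1 / 2) * ∑ u : V, ∑ v : V, resistanceDistance G u v

/-- `Kf_v(G) = ∑_{u ≠ v} r(v,u)` (the term `u = v` contributes `0`). -/
def kirchhoffAt [Fintype V] (G : SimpleGraph V) (v : V) : ℝ :=
  ∑ u : V, resistanceDistance G v u

/-- The Wiener index: sum of graph distances over unordered pairs of distinct vertices. -/
def wienerIndex [Fintype V] (G : SimpleGraph V) : ℝ :=
  (1 / 2) * ∑ u : V, ∑ v : V, (G.dist u v : ℝ)

/-- `W_v(G) = ∑_u d(v,u)`. -/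
def wienerAt [Fintype V] (G : SimpleGraph V) (v : V) : ℝ :=
  ∑ u : V, (G.dist v u : ℝ)

/-- The degree of a vertex. -/
def degree' (G : SimpleGraph V) (v : V) : ℕ := Nat.card (G.neighborSet v)

/-- `G` has maximum degree `Δ`. -/
def HasMaxDegree (G : SimpleGraph V) (Δ : ℕ) : Prop :=
  (∀ v, degree' G v ≤ Δ) ∧ ∃ v, degree' G v = Δ

/-- A unicyclic graph: a connected graph containing exactly one cycle, equivalently a
connected graph with as many edges as vertices. -/
def IsUnicyclic [Fintype V] (G : SimpleGraph V) : Prop :=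
  G.Connected ∧ Nat.card G.edgeSet = Fintype.card V

/-- The branch (tree) of `G` at `x` relative to a set `S` of vertices: the set of vertices
reachable from `x` by walks avoiding `S \ {x}`, i.e. the vertex set of the component of
`G − (S ∖ {x})` containing `x`. -/
def branch (G : SimpleGraph V) (S : Set V) (x : V) : Set V :=
  {u | ∃ p : G.Walk x u, ∀ y ∈ p.support, y ∉ S \ {x}}

/-- The net current flowing out of `x` under the potential `g`, that is, the value at `x` of the
graph Laplacian applied to `g`. -/
def netCurrent [Fintype V] (G : SimpleGraph V) (g : V → ℝ) (x : V) : ℝ :=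
  ∑ y : V, (if G.Adj x y then g x - g y else 0)

section Potential

variable [Fintype V] (G : SimpleGraph V)

lemma netCurrent_sub_mul (f g : V → ℝ) (c : ℝ) (x : V) :
    netCurrent G (fun y => f y - c * g y) x = netCurrent G f x - c * netCurrent G g x := by
  simp only [netCurrent, Finset.mul_sum, ← Finset.sum_sub_distrib]
  refine Finset.sum_congr rfl fun y _ => ?_
  split_ifs <;> ring

lemma energy_nonneg (f : V → ℝ) : 0 ≤ energy G f := by
  unfold energy
  refine mul_nonneg (by norm_num) (Finset.sum_nonneg fun x _ => Finset.sum_nonneg fun y _ => ?_)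
  split_ifs <;> positivity

lemma half_sum_mul_eq_sum_mul_netCurrent (f g : V → ℝ) :
    (1 / 2) * ∑ x : V, ∑ y : V, (if G.Adj x y then (f x - f y) * (g x - g y) else 0)
      = ∑ x, f x * netCurrent G g x := by
  have key : ∑ x : V, ∑ y : V, (if G.Adj x y then f y * (g x - g y) else 0)
      = - ∑ x : V, ∑ y : V, (if G.Adj x y then f x * (g x - g y) else 0) := by
    rw [Finset.sum_comm, ← Finset.sum_neg_distrib]
    refine Finset.sum_congr rfl fun x _ => ?_
    rw [← Finset.sum_neg_distrib]
    refine Finset.sum_congr rfl fun y _ => ?_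
    simp only [G.adj_comm y x]
    split_ifs <;> ring
  have split : ∑ x : V, ∑ y : V, (if G.Adj x y then (f x - f y) * (g x - g y) else 0)
      = ∑ x : V, ∑ y : V, (if G.Adj x y then f x * (g x - g y) else 0)
        - ∑ x : V, ∑ y : V, (if G.Adj x y then f y * (g x - g y) else 0) := by
    simp only [← Finset.sum_sub_distrib]
    refine Finset.sum_congr rfl fun x _ => Finset.sum_congr rfl fun y _ => ?_
    split_ifs <;> ring
  have out : ∑ x, f x * netCurrent G g x
      = ∑ x : V, ∑ y : V, (if G.Adj x y then f x * (g x - g y) else 0) := by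
    simp only [netCurrent, Finset.mul_sum, mul_ite, mul_zero]
  rw [split, key, out]
  ring

lemma energy_eq_sum_mul_netCurrent (g : V → ℝ) : energy G g = ∑ x, g x * netCurrent G g x := by
  rw [← half_sum_mul_eq_sum_mul_netCurrent, energy]
  simp only [sq]

lemma energy_sub_mul (f g : V → ℝ) (t : ℝ) :
    energy G (fun x => f x - t * g x)
      = energy G f - 2 * t * ∑ x, f x * netCurrent G g x + t ^ 2 * energy G g := by
  rw [← half_sum_mul_eq_sum_mul_netCurrent]
  simp only [energy, Finset.mul_sum, ← Finset.sum_sub_distrib, ← Finset.sum_add_distrib]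
  refine Finset.sum_congr rfl fun x _ => Finset.sum_congr rfl fun y _ => ?_
  split_ifs <;> ring

lemma resistanceDistance_comm (u v : V) : resistanceDistance G u v = resistanceDistance G v u := by
  have h : ∀ u v : V, {e : ℝ | ∃ f : V → ℝ, f u = 1 ∧ f v = 0 ∧ energy G f = e}
      ⊆ {e : ℝ | ∃ f : V → ℝ, f v = 1 ∧ f u = 0 ∧ energy G f = e} := by
    rintro u v e ⟨f, hu, hv, rfl⟩
    refine ⟨fun x => 1 - f x, by simp [hv], by simp [hu], ?_⟩
    unfold energy
    congr 1
    refine Finset.sum_congr rfl fun x _ => Finset.sum_congr rfl fun y _ => ?_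
    split_ifs <;> ring
  rw [resistanceDistance, resistanceDistance, (h u v).antisymm (h v u)]
  simp only [eq_comm]

/-- The effective resistance is the potential difference that drives a unit current. -/
theorem resistanceDistance_eq_of_netCurrent {u v : V} (huv : u ≠ v) (g : V → ℝ)
    (hg : ∀ x, netCurrent G g x = (if x = u then 1 else 0) - (if x = v then 1 else 0)) :
    resistanceDistance G u v = g u - g v := by
  have pair : ∀ f : V → ℝ, ∑ x, f x * netCurrent G g x = f u - f v := by
    intro f
    simp [hg, mul_sub, Finset.sum_sub_distrib]
  have hE : energy G g = g u - g v := by rw [energy_eq_sum_mul_netCurrent, pair]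
  set R := g u - g v with hR
  have hexp : ∀ (f : V → ℝ) (t : ℝ), f u = 1 → f v = 0 →
      0 ≤ energy G f - 2 * t + t ^ 2 * R := by
    intro f t hu hv
    have h := energy_nonneg G (fun x => f x - t * g x)
    rw [energy_sub_mul, pair, hu, hv, hE] at h
    linarith
  have hR0 : 0 ≤ R := hE ▸ energy_nonneg G g
  have hRpos : 0 < R := by
    refine lt_of_le_of_ne hR0 fun h0 => ?_
    set f : V → ℝ := fun x => if x = u then 1 else 0
    have h := hexp f (energy G f + 1) (by simp [f]) (by simp [f, huv.symm])
    have := energy_nonneg G f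
    rw [← h0] at h
    linarith
  have hleast : IsLeast {e : ℝ | ∃ f : V → ℝ, f u = 1 ∧ f v = 0 ∧ energy G f = e} (1 / R) := by
    constructor
    · refine ⟨fun x => (g x - g v) / R, by simp [← hR, hRpos.ne'], by simp, ?_⟩
      have : energy G (fun x => (g x - g v) / R) = energy G g / R ^ 2 := by
        simp only [energy, mul_div_assoc, Finset.sum_div]
        congr 1
        refine Finset.sum_congr rfl fun x _ => Finset.sum_congr rfl fun y _ => ?_
        split_ifs
        · field_simp
          ring
        · simp
      rw [this, hE]
      field_simp
    · rintro e ⟨f, hu, hv, rfl⟩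
      have h := hexp f (1 / R) hu hv
      have h2 : energy G f - 2 * (1 / R) + (1 / R) ^ 2 * R = energy G f - 1 / R := by
        field_simp
        ring
      linarith
  rw [resistanceDistance, if_neg huv, hleast.csInf_eq, one_div_one_div]

end Potential

section Tree

variable {T : SimpleGraph V}

lemma exists_adj_dist_add_one (hT : T.Connected) {x w : V} (hxw : x ≠ w) :
    ∃ y, T.Adj x y ∧ T.dist y w + 1 = T.dist x w := by
  obtain ⟨p, hp⟩ := hT.exists_walk_length_eq_dist x w
  cases p with
  | nil => exact absurd rfl hxw
  | cons h q =>
    refine ⟨_, h, ?_⟩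
    have h1 := SimpleGraph.dist_le q
    have h2 := hT.dist_triangle (u := x) (v := _) (w := w) |>.trans
      (Nat.add_le_add_right (SimpleGraph.dist_eq_one_iff_adj.mpr h).le _)
    rw [SimpleGraph.Walk.length_cons] at hp
    omega

lemma eq_of_adj_of_dist_add_one (hT : T.IsTree) {x w y z : V} (hy : T.Adj x y) (hz : T.Adj x z)
    (hyd : T.dist y w + 1 = T.dist x w) (hzd : T.dist z w + 1 = T.dist x w) : y = z := by
  obtain ⟨p, hp⟩ := hT.connected.exists_walk_length_eq_dist y w
  obtain ⟨q, hq⟩ := hT.connected.exists_walk_length_eq_dist z w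
  have hp' : (SimpleGraph.Walk.cons hy p).IsPath :=
    SimpleGraph.Walk.isPath_of_length_eq_dist _ (by simp [hp, hyd])
  have hq' : (SimpleGraph.Walk.cons hz q).IsPath :=
    SimpleGraph.Walk.isPath_of_length_eq_dist _ (by simp [hq, hzd])
  have h := (hT.existsUnique_path x w).unique hp' hq'
  simpa using congrArg SimpleGraph.Walk.snd h

variable [Fintype V]

/-- The Laplacian of the distance function to `w` in a tree. -/
lemma netCurrent_dist (hT : T.IsTree) (w x : V) :
    netCurrent T (fun y => (T.dist y w : ℝ)) x
      = 2 - 2 * (if x = w then 1 else 0) - ∑ y : V, (if T.Adj x y then (1 : ℝ) else 0) := by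
  unfold netCurrent
  have step : ∀ {y}, T.Adj x y → T.dist x w = T.dist y w + 1 ∨ T.dist y w = T.dist x w + 1 := by
    intro y h
    rw [T.dist_comm (u := x), T.dist_comm (u := y)]
    exact hT.dist_eq_dist_add_one_of_adj w h
  by_cases hxw : x = w
  · subst hxw
    rw [eq_sub_iff_add_eq, ← Finset.sum_add_distrib]
    simp only [if_true]
    rw [Finset.sum_eq_zero]
    · norm_num
    · intro y _
      split_ifs with h
      · rw [T.dist_comm (u := y), SimpleGraph.dist_eq_one_iff_adj.mpr h]
        simp
      · simp
  · obtain ⟨y₀, hy₀, hd₀⟩ := exists_adj_dist_add_one hT.connected hxw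
    rw [eq_sub_iff_add_eq, ← Finset.sum_add_distrib, Finset.sum_eq_single y₀]
    · simp only [if_pos hy₀, if_neg hxw, ← hd₀]
      push_cast
      ring
    · intro y _ hy
      split_ifs with h
      · rcases step h with h' | h'
        · exact absurd (eq_of_adj_of_dist_add_one hT h hy₀ h'.symm hd₀) hy
        · simp only [h']
          push_cast
          ring
      · simp
    · simp

/-- Half the difference of two distance functions is the potential of a unit current in a tree. -/
lemma netCurrent_half_dist_sub_dist (hT : T.IsTree) (u w x : V) :
    netCurrent T (fun y => ((T.dist y w : ℝ) - T.dist y u) / 2) x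
      = (if x = u then 1 else 0) - (if x = w then 1 else 0) := by
  have h : netCurrent T (fun y => ((T.dist y w : ℝ) - T.dist y u) / 2) x
      = (netCurrent T (fun y => (T.dist y w : ℝ)) x
        - netCurrent T (fun y => (T.dist y u : ℝ)) x) / 2 := by
    unfold netCurrent
    rw [← Finset.sum_sub_distrib, Finset.sum_div]
    refine Finset.sum_congr rfl fun y _ => ?_
    split_ifs <;> ring
  rw [h, netCurrent_dist hT, netCurrent_dist hT]
  ring

lemma netCurrent_deleteEdges {G : SimpleGraph V} {a b : V} (hab : G.Adj a b) (g : V → ℝ) (x : V) :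
    netCurrent G g x = netCurrent (G.deleteEdges {s(a, b)}) g x
      + (g a - g b) * ((if x = a then 1 else 0) - (if x = b then 1 else 0)) := by
  have hne := hab.ne
  obtain ⟨T, hT⟩ : ∃ T, T = G.deleteEdges {s(a, b)} := ⟨_, rfl⟩
  rw [← hT]
  have h : ∀ y, (if G.Adj x y then g x - g y else 0)
      = (if T.Adj x y then g x - g y else 0)
        + ((if y = b then (if x = a then g a - g b else 0) else 0)
          + (if y = a then (if x = b then g b - g a else 0) else 0)) := by
    intro y
    simp only [hT, SimpleGraph.deleteEdges_adj, Set.mem_singleton_iff, Sym2.eq_iff]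
    by_cases h1 : x = a ∧ y = b
    · obtain ⟨rfl, rfl⟩ := h1
      simp [hab, hne, hne.symm]
    · by_cases h2 : x = b ∧ y = a
      · obtain ⟨rfl, rfl⟩ := h2
        simp [hab.symm, hne, hne.symm]
      · have e1 : (if y = b then (if x = a then g a - g b else 0) else 0) = 0 := by
          split_ifs <;> simp_all
        have e2 : (if y = a then (if x = b then g b - g a else 0) else 0) = 0 := by
          split_ifs <;> simp_all
        rw [e1, e2]
        simp [h1, h2]
  unfold netCurrent
  rw [Finset.sum_congr rfl fun y _ => h y, Finset.sum_add_distrib, Finset.sum_add_distrib,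
    Finset.sum_ite_eq', Finset.sum_ite_eq']
  simp only [Finset.mem_univ, if_true]
  split_ifs <;> ring

/-- Effective resistances in a tree with one extra edge, in terms of distances in the tree. -/
theorem resistanceDistance_eq_of_isTree_deleteEdges {G : SimpleGraph V} {a b : V}
    (hab : G.Adj a b) (hT : (G.deleteEdges {s(a, b)}).IsTree) (u w : V) :
    resistanceDistance G u w = (G.deleteEdges {s(a, b)}).dist u w
      - (((G.deleteEdges {s(a, b)}).dist u b : ℝ) - (G.deleteEdges {s(a, b)}).dist u a
        - (G.deleteEdges {s(a, b)}).dist w b + (G.deleteEdges {s(a, b)}).dist w a) ^ 2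
        / (4 * (1 + (G.deleteEdges {s(a, b)}).dist a b)) := by
  by_cases huw : u = w
  · subst huw
    simp [resistanceDistance]
  set T := G.deleteEdges {s(a, b)} with hTdef
  have hpos : (0 : ℝ) < 1 + T.dist a b := by positivity
  set c : ℝ := (((T.dist a w : ℝ) - T.dist a u) / 2 - ((T.dist b w : ℝ) - T.dist b u) / 2)
    / (1 + T.dist a b) with hc
  have hcm : c * (1 + T.dist a b)
      = ((T.dist a w : ℝ) - T.dist a u) / 2 - ((T.dist b w : ℝ) - T.dist b u) / 2 := by
    rw [hc, div_mul_cancel₀ _ hpos.ne']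
  rw [resistanceDistance_eq_of_netCurrent G huw
    (fun y => ((T.dist y w : ℝ) - T.dist y u) / 2 - c * (((T.dist y b : ℝ) - T.dist y a) / 2))]
  · simp only [T.dist_self, T.dist_comm (u := w) (v := u), T.dist_comm (u := u) (v := a),
      T.dist_comm (u := u) (v := b), T.dist_comm (u := w) (v := a), T.dist_comm (u := w) (v := b),
      hc]
    push_cast
    field_simp
    ring
  · intro x
    rw [netCurrent_deleteEdges hab, ← hTdef, netCurrent_sub_mul, netCurrent_half_dist_sub_dist hT,
      netCurrent_half_dist_sub_dist hT]
    simp only [T.dist_self, T.dist_comm (u := b) (v := a)]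
    push_cast
    linear_combination
      (-((if x = a then (1 : ℝ) else 0) - (if x = b then 1 else 0))) * hcm

end Tree

section Branch

variable {G T : SimpleGraph V} {S : Set V} {x u w : V}

lemma mem_branch_self (G : SimpleGraph V) (S : Set V) (x : V) : x ∈ branch G S x :=
  ⟨SimpleGraph.Walk.nil, by simp⟩

lemma notMem_of_mem_branch (hu : u ∈ branch G S x) : u ∉ S \ {x} := by
  obtain ⟨p, hp⟩ := hu
  exact hp u p.end_mem_support

lemma mem_branch_of_adj (hu : u ∈ branch G S x) (huw : G.Adj u w) (hw : w ∉ S \ {x}) :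
    w ∈ branch G S x := by
  obtain ⟨p, hp⟩ := hu
  refine ⟨p.concat huw, fun y hy => ?_⟩
  rw [SimpleGraph.Walk.support_concat, List.mem_append, List.mem_singleton] at hy
  rcases hy with hy | rfl
  · exact hp y hy
  · exact hw

lemma exists_mem_branch_of_walk (p : G.Walk u w) (hw : w ∈ S) : ∃ x ∈ S, u ∈ branch G S x := by
  induction p with
  | nil => exact ⟨_, hw, mem_branch_self G S _⟩
  | @cons u y w h q ih =>
    by_cases hu : u ∈ S
    · exact ⟨u, hu, mem_branch_self G S u⟩
    · obtain ⟨x, hx, hy⟩ := ih hw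
      exact ⟨x, hx, mem_branch_of_adj hy h.symm fun h' => hu h'.1⟩

lemma preconnected_induce_branch (G : SimpleGraph V) (S : Set V) (x : V) :
    (G.induce (branch G S x)).Preconnected := by
  have key : ∀ u : branch G S x,
      (G.induce (branch G S x)).Reachable ⟨x, mem_branch_self G S x⟩ u := by
    rintro ⟨u, p, hp⟩
    have hsub : ∀ y ∈ p.support, y ∈ branch G S x := fun y hy =>
      ⟨p.takeUntil y hy, fun z hz => hp z (p.support_takeUntil_subset_support hy hz)⟩
    exact ⟨p.induce _ hsub⟩
  exact fun u w => (key u).symm.trans (key w)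

lemma branch_deleteEdges {a b : V} (hab : a ≠ b) (ha : a ∈ S) (hb : b ∈ S) (x : V) :
    branch (G.deleteEdges {s(a, b)}) S x = branch G S x := by
  ext u
  constructor
  · rintro ⟨p, hp⟩
    exact ⟨p.mapLe (SimpleGraph.deleteEdges_le _), by simpa using hp⟩
  · rintro ⟨p, hp⟩
    refine ⟨p.toDeleteEdge s(a, b) fun he => hab ?_, by simpa using hp⟩
    have h1 := hp a (p.fst_mem_support_of_mem_edges he)
    have h2 := hp b (p.snd_mem_support_of_mem_edges he)
    simp only [Set.mem_sdiff, Set.mem_singleton_iff, not_and, not_not] at h1 h2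
    rw [h1 ha, h2 hb]

lemma length_eq_dist_of_isPath (hT : T.IsTree) {p : T.Walk u w} (hp : p.IsPath) :
    p.length = T.dist u w := by
  obtain ⟨q, hq, hd⟩ := hT.connected.exists_path_of_dist u w
  rw [(hT.existsUnique_path u w).unique hp hq, hd]

/-- A connected graph that embeds in a tree does so isometrically. -/
lemma dist_eq_dist_of_injective_hom {H : SimpleGraph W} (hH : H.Preconnected) (hT : T.IsTree)
    (f : H →g T) (hf : Function.Injective f) (u w : W) : H.dist u w = T.dist (f u) (f w) := by
  obtain ⟨p, hp, hd⟩ := (hH u w).exists_path_of_dist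
  rw [← hd, ← length_eq_dist_of_isPath hT (hp.map hf),
    SimpleGraph.Walk.length_map]

lemma dist_eq_add_of_forall_mem_support (hG : G.Connected)
    (h : ∀ p : G.Walk u w, x ∈ p.support) : G.dist u w = G.dist u x + G.dist x w := by
  refine le_antisymm hG.dist_triangle ?_
  obtain ⟨p, hp⟩ := hG.exists_walk_length_eq_dist u w
  have h1 := SimpleGraph.dist_le (p.takeUntil x (h p))
  have h2 := SimpleGraph.dist_le (p.dropUntil x (h p))
  have h3 := congrArg SimpleGraph.Walk.length (p.take_spec (h p))
  rw [SimpleGraph.Walk.length_append] at h3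
  omega

/-- If distinct branches are disjoint, then every walk leaving a branch passes through its root. -/
lemma root_mem_support (hdisj : ∀ y ∈ S, y ≠ x → Disjoint (branch G S x) (branch G S y))
    (hu : u ∈ branch G S x) (hw : w ∉ branch G S x) (p : G.Walk u w) : x ∈ p.support := by
  obtain ⟨d, hd, h1, h2⟩ := p.exists_boundary_dart _ hu hw
  have hS : d.snd ∈ S \ {x} := by
    by_contra hS
    exact h2 (mem_branch_of_adj h1 d.adj hS)
  suffices d.fst = x from this ▸ p.dart_fst_mem_support_of_mem_darts hd
  by_contra hne
  refine Set.disjoint_left.mp (hdisj _ hS.1 hS.2) h1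
    (mem_branch_of_adj (mem_branch_self G S _) d.adj.symm fun h => ?_)
  exact notMem_of_mem_branch h1 ⟨h.1, hne⟩

end Branch

section Spine

variable {T : SimpleGraph V} {l : ℕ} {v : Fin l → V}

lemma exists_isPath_spine (hinj : Function.Injective v)
    (hadj : ∀ (k : ℕ) (h : k + 1 < l), T.Adj (v ⟨k, by omega⟩) (v ⟨k + 1, h⟩))
    (i n : ℕ) (h : i + n < l) :
    ∃ p : T.Walk (v ⟨i, by omega⟩) (v ⟨i + n, h⟩), p.IsPath ∧ p.length = n ∧
      ∀ x ∈ p.support, ∃ k : Fin l, i ≤ k ∧ k ≤ i + n ∧ x = v k := by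
  induction n with
  | zero => exact ⟨SimpleGraph.Walk.nil, by simp, rfl,
      fun x hx => ⟨⟨i, by omega⟩, le_rfl, le_rfl, by simpa using hx⟩⟩
  | succ n ih =>
    obtain ⟨p, hp, hlen, hsupp⟩ := ih (by omega)
    refine ⟨p.concat (hadj (i + n) h), hp.concat (fun hmem => ?_) _, by simp [hlen], ?_⟩
    · obtain ⟨k, -, hk, he⟩ := hsupp _ hmem
      have := congrArg Fin.val (hinj he)
      simp at this
      omega
    · intro x hx
      rw [SimpleGraph.Walk.support_concat, List.mem_append, List.mem_singleton] at hx
      rcases hx with hx | rfl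
      · obtain ⟨k, h1, h2, he⟩ := hsupp x hx
        exact ⟨k, h1, by omega, he⟩
      · exact ⟨⟨i + (n + 1), h⟩, by simp, by simp, rfl⟩

lemma dist_spine (hT : T.IsTree) (hinj : Function.Injective v)
    (hadj : ∀ (k : ℕ) (h : k + 1 < l), T.Adj (v ⟨k, by omega⟩) (v ⟨k + 1, h⟩)) (i j : Fin l) :
    (T.dist (v i) (v j) : ℝ) = |(i : ℝ) - j| := by
  have key : ∀ i j : Fin l, i ≤ j → (T.dist (v i) (v j) : ℝ) = |(i : ℝ) - j| := by
    rintro ⟨i, hi⟩ ⟨j, hj⟩ hij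
    obtain ⟨n, rfl⟩ := Nat.exists_eq_add_of_le (Fin.mk_le_mk.mp hij)
    obtain ⟨p, hp, hlen, -⟩ := exists_isPath_spine hinj hadj i n hj
    rw [← length_eq_dist_of_isPath hT hp, hlen]
    simp
  rcases le_total i j with h | h
  · exact key i j h
  · rw [T.dist_comm, key j i h, abs_sub_comm]

lemma disjoint_branch_spine (hT : T.IsTree) (hinj : Function.Injective v)
    (hadj : ∀ (k : ℕ) (h : k + 1 < l), T.Adj (v ⟨k, by omega⟩) (v ⟨k + 1, h⟩)) {i j : Fin l}
    (hij : i ≠ j) :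
    Disjoint (branch T (Set.range v) (v i)) (branch T (Set.range v) (v j)) := by
  wlog hlt : i < j generalizing i j
  · exact (this hij.symm (lt_of_le_of_ne (not_lt.mp hlt) hij.symm)).symm
  rw [Set.disjoint_left]
  rintro u ⟨p, hp⟩ ⟨q, hq⟩
  obtain ⟨i, hi⟩ := i
  obtain ⟨j, hj⟩ := j
  obtain ⟨n, rfl⟩ := Nat.exists_eq_add_of_le (Nat.succ_le_of_lt (Fin.mk_lt_mk.mp hlt))
  have hi1 : i + 1 < l := by omega
  obtain ⟨c, -, -, hc⟩ := exists_isPath_spine hinj hadj (i + 1) n (by omega)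
  have hbr := SimpleGraph.isAcyclic_iff_forall_adj_isBridge.mp hT.isAcyclic (hadj i hi1)
  have hmem := SimpleGraph.isBridge_iff_forall_walk_mem_edges.mp hbr
    ((p.append q.reverse).append c.reverse)
  simp only [SimpleGraph.Walk.edges_append, SimpleGraph.Walk.edges_reverse, List.mem_append,
    List.mem_reverse] at hmem
  rcases hmem with (h | h) | h
  · refine hp _ (p.snd_mem_support_of_mem_edges h) ⟨Set.mem_range_self _, fun he => ?_⟩
    simpa using hinj he
  · refine hq _ (q.fst_mem_support_of_mem_edges h) ⟨Set.mem_range_self _, fun he => ?_⟩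
    have := congrArg Fin.val (hinj he)
    simp at this
    omega
  · obtain ⟨k, hk, -, he⟩ := hc _ (c.fst_mem_support_of_mem_edges h)
    have := congrArg Fin.val (hinj he)
    simp at this
    omega

end Spine

section Sum

lemma sum_eq_sum_sum_subtype [Fintype V] {ι : Type*} [Fintype ι] (B : ι → Set V)
    (hB : ∀ u, ∃! i, u ∈ B i) (F : V → ℝ) : ∑ u, F u = ∑ i, ∑ u : B i, F u := by
  have h : ∀ i, ∑ u : B i, F u = ∑ u, if u ∈ B i then F u else 0 := by
    intro i
    rw [← Finset.sum_filter]
    exact (Finset.sum_subtype _ (by simp) F).symm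
  simp only [h]
  rw [Finset.sum_comm]
  refine Finset.sum_congr rfl fun u _ => ?_
  obtain ⟨i, hi, huniq⟩ := hB u
  rw [Finset.sum_eq_single i]
  · rw [if_pos hi]
  · exact fun j _ hj => if_neg fun h => hj (huniq j h)
  · simp

lemma half_sum_sum_of_symm {ι : Type*} [Fintype ι] [LinearOrder ι] (F : ι → ι → ℝ)
    (hF : ∀ i j, F i j = F j i) :
    (1 / 2) * ∑ i, ∑ j, F i j
      = ∑ i, (1 / 2) * F i i + ∑ i, ∑ j, if i < j then F i j else 0 := by
  have h1 : ∑ i, ∑ j, (if j < i then F i j else 0) = ∑ i, ∑ j, if i < j then F i j else 0 := by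
    rw [Finset.sum_comm]
    simp only [hF]
  have h2 : ∑ i, ∑ j, F i j = ∑ i, F i i + ∑ i, ∑ j, (if i < j then F i j else 0)
      + ∑ i, ∑ j, (if j < i then F i j else 0) := by
    have h3 : ∑ i, F i i = ∑ i, ∑ j, if i = j then F i j else 0 := by simp
    rw [h3]
    simp only [← Finset.sum_add_distrib]
    refine Finset.sum_congr rfl fun i _ => Finset.sum_congr rfl fun j _ => ?_
    rcases lt_trichotomy i j with h | h | h
    · simp [h, h.ne, h.not_gt]
    · simp [h]
    · simp [h, h.ne', h.not_gt]
  rw [h2, h1, ← Finset.mul_sum]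
  ring

end Sum

section Unicyclic

variable [Fintype V] {G : SimpleGraph V}

/-- Deleting an edge whose ends are otherwise joined turns a unicyclic graph into a tree. -/
lemma isTree_deleteEdges_of_isUnicyclic (huni : IsUnicyclic G) {a b : V} (hab : G.Adj a b)
    (hr : (G.deleteEdges {s(a, b)}).Reachable a b) : (G.deleteEdges {s(a, b)}).IsTree := by
  rw [SimpleGraph.isTree_iff_connected_and_card]
  refine ⟨huni.1.connected_delete_edge_of_not_isBridge fun h => h hr, ?_⟩
  rw [SimpleGraph.edgeSet_deleteEdges, Nat.card_eq_fintype_card (α := V), ← huni.2,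
    Nat.card_coe_set_eq, Nat.card_coe_set_eq]
  exact Set.ncard_sdiff_singleton_add_one hab (Set.toFinite _)

/-- In a unicyclic graph the branches at the cycle partition the vertices, and resistances are the
sums of the distances inside the branches and the resistance along the cycle. -/
theorem resistanceDistance_of_isUnicyclic {m : ℕ} {v : Fin (m + 1) → V} (hm : 2 ≤ m)
    (huni : IsUnicyclic G) (hinj : Function.Injective v)
    (hadj : ∀ (k : ℕ) (h : k + 1 < m + 1), G.Adj (v ⟨k, by omega⟩) (v ⟨k + 1, h⟩))
    (hlast : G.Adj (v (Fin.last m)) (v 0)) :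
    (∀ u, ∃! i, u ∈ branch G (Set.range v) (v i)) ∧
    (∀ i, ∀ u w : branch G (Set.range v) (v i),
      resistanceDistance G u w = (G.induce (branch G (Set.range v) (v i))).dist u w) ∧
    (∀ i j, i ≠ j → ∀ (u : branch G (Set.range v) (v i)) (w : branch G (Set.range v) (v j)),
      resistanceDistance G u w
        = (G.induce (branch G (Set.range v) (v i))).dist ⟨v i, mem_branch_self G _ _⟩ u
          + (|(i : ℝ) - j| - ((i : ℝ) - j) ^ 2 / (m + 1 : ℕ))
          + (G.induce (branch G (Set.range v) (v j))).dist ⟨v j, mem_branch_self G _ _⟩ w) := by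
  set a := v (Fin.last m) with ha
  set b := v 0 with hb
  have hab : G.Adj a b := hlast
  obtain ⟨T, hTdef⟩ : ∃ T, T = G.deleteEdges {s(a, b)} := ⟨_, rfl⟩
  have hadjT : ∀ (k : ℕ) (h : k + 1 < m + 1), T.Adj (v ⟨k, by omega⟩) (v ⟨k + 1, h⟩) := by
    intro k h
    rw [hTdef, SimpleGraph.deleteEdges_adj]
    refine ⟨hadj k h, fun he => ?_⟩
    rw [Set.mem_singleton_iff, Sym2.eq_iff, hinj.eq_iff, hinj.eq_iff, hinj.eq_iff,
      hinj.eq_iff] at he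
    simp only [Fin.ext_iff, Fin.val_last, Fin.val_zero] at he
    omega
  have hT : T.IsTree := by
    rw [hTdef]
    refine isTree_deleteEdges_of_isUnicyclic huni hab ?_
    obtain ⟨p, -⟩ := exists_isPath_spine hinj hadjT 0 m (by omega)
    have h1 : v ⟨0 + m, by omega⟩ = a := congrArg v (Fin.ext (Nat.zero_add m))
    rw [← hTdef, ← h1]
    exact p.reachable.symm
  have hbr : ∀ x, branch G (Set.range v) x = branch T (Set.range v) x := fun x => by
    rw [hTdef, branch_deleteEdges hab.ne (Set.mem_range_self _) (Set.mem_range_self _)]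
  have hdisj : ∀ i j, i ≠ j →
      Disjoint (branch T (Set.range v) (v i)) (branch T (Set.range v) (v j)) :=
    fun i j hij => disjoint_branch_spine hT hinj hadjT hij
  have hcross : ∀ i j, i ≠ j → ∀ u ∈ branch T (Set.range v) (v i),
      ∀ w ∈ branch T (Set.range v) (v j), T.dist u w = T.dist u (v i) + T.dist (v i) w := by
    intro i j hij u hu w hw
    refine dist_eq_add_of_forall_mem_support hT.connected fun p => root_mem_support ?_ hu
      (Set.disjoint_right.mp (hdisj i j hij) hw) p
    rintro _ ⟨k, rfl⟩ hk
    exact hdisj i k fun h => hk (h ▸ rfl)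
  have hroot : ∀ i k, ∀ u ∈ branch T (Set.range v) (v i),
      (T.dist u (v k) : ℝ) = T.dist u (v i) + |(i : ℝ) - k| := by
    intro i k u hu
    by_cases hik : i = k
    · simp [hik]
    · rw [hcross i k hik u hu _ (mem_branch_self T _ _)]
      push_cast
      rw [dist_spine hT hinj hadjT]
  have hind : ∀ i, ∀ u w : branch G (Set.range v) (v i),
      (G.induce (branch G (Set.range v) (v i))).dist u w = T.dist u w := by
    intro i
    refine dist_eq_dist_of_injective_hom (preconnected_induce_branch G _ _) hT
      ⟨Subtype.val, fun {x y} hxy => ?_⟩ Subtype.val_injective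
    have hxy' : G.Adj x y := hxy
    rw [hTdef, SimpleGraph.deleteEdges_adj]
    refine ⟨hxy', fun he => ?_⟩
    have hroot : ∀ z : branch G (Set.range v) (v i), (z : V) ∈ Set.range v → (z : V) = v i :=
      fun z hz => by_contra fun h => notMem_of_mem_branch z.2 ⟨hz, h⟩
    rw [Set.mem_singleton_iff, Sym2.eq_iff] at he
    refine hxy'.ne ?_
    rw [hroot x, hroot y]
    · rcases he with ⟨-, h⟩ | ⟨-, h⟩ <;> exact h ▸ Set.mem_range_self _
    · rcases he with ⟨h, -⟩ | ⟨h, -⟩ <;> exact h ▸ Set.mem_range_self _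
  have hres : ∀ i j, ∀ u ∈ branch T (Set.range v) (v i), ∀ w ∈ branch T (Set.range v) (v j),
      resistanceDistance G u w = T.dist u w - ((i : ℝ) - j) ^ 2 / (m + 1 : ℕ) := by
    intro i j u hu w hw
    have hlast : ∀ k : Fin (m + 1), |(k : ℝ) - (Fin.last m : Fin (m + 1))| = m - k := by
      intro k
      have : (k : ℝ) ≤ m := by exact_mod_cast Fin.is_le k
      rw [Fin.val_last, abs_sub_comm, abs_of_nonneg (by linarith)]
    have hzero : ∀ k : Fin (m + 1), |(k : ℝ) - (0 : Fin (m + 1))| = k := by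
      intro k
      simp
    rw [resistanceDistance_eq_of_isTree_deleteEdges hab (hTdef ▸ hT), ← hTdef, hroot i 0 u hu,
      hroot i (Fin.last m) u hu, hroot j 0 w hw, hroot j (Fin.last m) w hw, dist_spine hT hinj hadjT,
      hlast, hlast, hzero, hzero, hzero]
    have : (0 : ℝ) < m + 1 := by positivity
    push_cast
    field_simp
    ring
  refine ⟨fun u => ?_, fun i u w => ?_, fun i j hij u w => ?_⟩
  · obtain ⟨p⟩ := hT.connected u (v 0)
    obtain ⟨_, ⟨i, rfl⟩, hi⟩ := exists_mem_branch_of_walk p (Set.mem_range_self 0)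
    simp only [hbr]
    refine ⟨i, hi, fun j hj => by_contra fun hji => Set.disjoint_left.mp (hdisj j i hji) hj hi⟩
  · rw [hind, hres i i u (hbr _ ▸ u.2) w (hbr _ ▸ w.2)]
    simp
  · rw [hind, hind, hres i j u (hbr _ ▸ u.2) w (hbr _ ▸ w.2),
      hcross i j hij u (hbr _ ▸ u.2) w (hbr _ ▸ w.2), T.dist_comm (u := v i) (v := w),
      T.dist_comm (u := v i) (v := u), T.dist_comm (u := v j) (v := w)]
    push_cast
    rw [hroot j i w (hbr _ ▸ w.2), abs_sub_comm]
    ring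

end Unicyclic

/-- The Kirchhoff index of a unicyclic graph `G = U(C_l; T_1,…,T_l)` in terms of the
Wiener indices of its branch trees `T_i` (the components of `G − (V(C_l) ∖ {v_i})`),
their orders `n_i`, and the resistance distances `(j−i)(l−j+i)/l` along the cycle. -/
theorem statement2 [Fintype V] (G : SimpleGraph V) (l : ℕ) (hl : 3 ≤ l)
    (huni : IsUnicyclic G)
    (v : Fin l → V) (hinj : Function.Injective v)
    (hadj : ∀ i : Fin l, G.Adj (v i) (v ⟨(i.val + 1) % l, Nat.mod_lt _ (by omega)⟩))
    (hmem : ∀ i : Fin l, v i ∈ branch G (Set.range v) (v i)) :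
    kirchhoffIndex G =
      (∑ i : Fin l, wienerIndex (G.induce (branch G (Set.range v) (v i))))
      + ∑ i : Fin l, ∑ j : Fin l, (if i < j then
          (Nat.card (branch G (Set.range v) (v j)) : ℝ)
              * wienerAt (G.induce (branch G (Set.range v) (v i))) ⟨v i, hmem i⟩
          + (Nat.card (branch G (Set.range v) (v i)) : ℝ)
              * (Nat.card (branch G (Set.range v) (v j)) : ℝ)
              * ((((j : ℕ) - (i : ℕ)) * (l - (j : ℕ) + (i : ℕ)) : ℕ) : ℝ) / (l : ℝ)
          + (Nat.card (branch G (Set.range v) (v i)) : ℝ)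
              * wienerAt (G.induce (branch G (Set.range v) (v j))) ⟨v j, hmem j⟩
        else 0) := by
  obtain ⟨m, rfl⟩ : ∃ m, l = m + 1 := ⟨l - 1, by omega⟩
  have hspine : ∀ (k : ℕ) (h : k + 1 < m + 1), G.Adj (v ⟨k, by omega⟩) (v ⟨k + 1, h⟩) := by
    intro k h
    simpa only [Nat.mod_eq_of_lt h] using hadj ⟨k, by omega⟩
  have hlast : G.Adj (v (Fin.last m)) (v 0) := by
    simpa using hadj (Fin.last m)
  obtain ⟨hpart, hsame, hdiff⟩ :=
    resistanceDistance_of_isUnicyclic (by omega) huni hinj hspine hlast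
  set B : Fin (m + 1) → Set V := fun i => branch G (Set.range v) (v i)
  have hpairs : ∑ u, ∑ w, resistanceDistance G u w
      = ∑ i, ∑ j, ∑ u : B i, ∑ w : B j, resistanceDistance G u w := by
    rw [sum_eq_sum_sum_subtype B hpart]
    refine Finset.sum_congr rfl fun i _ => ?_
    rw [Finset.sum_congr rfl fun (u : B i) _ => sum_eq_sum_sum_subtype B hpart _, Finset.sum_comm]
  rw [kirchhoffIndex, hpairs, half_sum_sum_of_symm]
  · congr 1
    · refine Finset.sum_congr rfl fun i _ => ?_
      rw [wienerIndex]
      congr 1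
      exact Finset.sum_congr rfl fun u _ => Finset.sum_congr rfl fun w _ => hsame i u w
    · refine Finset.sum_congr rfl fun i _ => Finset.sum_congr rfl fun j _ => ?_
      split_ifs with hij
      · rw [Finset.sum_congr rfl fun u _ => Finset.sum_congr rfl fun w _ => hdiff i j hij.ne u w]
        simp only [Finset.sum_add_distrib, Finset.sum_const, Finset.card_univ, nsmul_eq_mul,
          ← Finset.mul_sum, ← Nat.card_eq_fintype_card]
        have hij' : (i : ℝ) < j := by exact_mod_cast hij
        have hl0 : (0 : ℝ) < m + 1 := by positivity
        have hc : ((((j : ℕ) - (i : ℕ)) * (m + 1 - (j : ℕ) + (i : ℕ)) : ℕ) : ℝ) / ((m + 1 : ℕ) : ℝ)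
            = |(i : ℝ) - j| - ((i : ℝ) - j) ^ 2 / (m + 1 : ℕ) := by
          rw [abs_sub_comm, abs_of_pos (sub_pos.mpr hij')]
          push_cast [Nat.cast_sub (Fin.le_def.mp hij.le), Nat.cast_sub j.2.le]
          field_simp
          ring
        rw [mul_div_assoc, hc]
        simp only [wienerAt]
        ring
      · rfl
  · intro i j
    rw [Finset.sum_comm]
    exact Finset.sum_congr rfl fun u _ => Finset.sum_congr rfl fun w _ =>
      resistanceDistance_comm G _ _

end KfPaper
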